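/- arXiv:2505.12197 — 3 statements merged into one kernel-verified Lean document; each statement's English description precedes it below -/
import Mathlib

section
/- There exists a universal constant C > 0 such that for every bounded measurable function f : S² → ℝ and every point x ∈ S², one has ∫_{S²} |f(y)| / ‖x − y‖ dσ(y) ≤ C · √(‖f‖_{L∞(S²)} · ‖f‖_{L¹(S²)}), where ‖x − y‖ is the Euclidean norm in ℝ³. -/
open MeasureTheory Metric

open Set in
theorem hausdorffMeasure_le_of_edist_le {X Y : Type*} [EMetricSpace X] [MeasurableSpace X]
    [BorelSpace X] [EMetricSpace Y] [MeasurableSpace Y] [BorelSpace Y] {f : X → Y} {s : Set X}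
    {K : NNReal} (h : ∀ a ∈ s, ∀ b ∈ s, edist a b ≤ K * edist (f a) (f b)) {d : ℝ} (hd : 0 ≤ d) :
    μH[d] s ≤ (K : ENNReal) ^ d * μH[d] (f '' s) := by
  have ha : AntilipschitzWith K (s.domRestrict f) := fun a b => h a a.2 b b.2
  have h1 := ha.le_hausdorffMeasure_image hd univ
  have h2 := (isometry_subtype_coe (s := s)).hausdorffMeasure_image (Or.inl hd) univ
  rw [image_univ, Subtype.range_coe] at h2
  rwa [image_univ, range_domRestrict, ← h2] at h1

theorem dist_le_six_mul_dist_removeNth {a b : EuclideanSpace ℝ (Fin 3)}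
    (ha : ‖a‖ = 1) (hb : ‖b‖ = 1) {i : Fin 3} {s : ℝ} (hs : s ^ 2 = 1)
    (hia : 1 / 2 ≤ s * a i) (hib : 1 / 2 ≤ s * b i) :
    dist a b ≤ 6 * dist (i.removeNth a) (i.removeNth b) := by
  set δ := dist (i.removeNth a) (i.removeNth b) with hδ
  have hδ0 : 0 ≤ δ := dist_nonneg
  have hc (j : Fin 2) : |a (i.succAbove j) - b (i.succAbove j)| ≤ δ := by
    rw [← Real.dist_eq]
    exact dist_le_pi_dist (i.removeNth a) (i.removeNth b) j
  have hsq {y : EuclideanSpace ℝ (Fin 3)} (hy : ‖y‖ = 1) :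
      y i ^ 2 + (y (i.succAbove 0) ^ 2 + y (i.succAbove 1) ^ 2) = 1 := by
    have := EuclideanSpace.real_norm_sq_eq y
    rw [Fin.sum_univ_succAbove _ i, Fin.sum_univ_two, hy] at this
    linarith
  have h1 {y : EuclideanSpace ℝ (Fin 3)} (hy : ‖y‖ = 1) (j : Fin 3) : |y j| ≤ 1 := by
    rw [← hy]; exact PiLp.norm_apply_le y j
  have hdiff (j : Fin 2) :
      |b (i.succAbove j) ^ 2 - a (i.succAbove j) ^ 2| ≤ 2 * δ := by
    rw [sq_sub_sq, abs_mul, abs_sub_comm]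
    refine mul_le_mul ?_ (hc j) (abs_nonneg _) (by norm_num)
    exact (abs_add_le _ _).trans (by linarith [h1 ha (i.succAbove j), h1 hb (i.succAbove j)])
  have hi : |a i - b i| ≤ 4 * δ := by
    have e : (s * (a i - b i)) * (s * a i + s * b i) =
        (b (i.succAbove 0) ^ 2 - a (i.succAbove 0) ^ 2) +
        (b (i.succAbove 1) ^ 2 - a (i.succAbove 1) ^ 2) := by
      linear_combination (a i ^ 2 - b i ^ 2) * hs + hsq ha - hsq hb
    have hs1 : |s| = 1 := by rw [← sq_eq_sq₀ (abs_nonneg s) zero_le_one, sq_abs, hs, one_pow]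
    have e2 := congrArg abs e
    rw [abs_mul, abs_mul, hs1, one_mul] at e2
    have h3 : |a i - b i| * 1 ≤ |a i - b i| * |s * a i + s * b i| :=
      mul_le_mul_of_nonneg_left (le_trans (by linarith) (le_abs_self _)) (abs_nonneg _)
    have := abs_add_le (b (i.succAbove 0) ^ 2 - a (i.succAbove 0) ^ 2)
      (b (i.succAbove 1) ^ 2 - a (i.succAbove 1) ^ 2)
    linarith [hdiff 0, hdiff 1]
  rw [EuclideanSpace.dist_eq, Fin.sum_univ_succAbove _ i, Fin.sum_univ_two]
  simp only [Real.dist_eq]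
  apply Real.sqrt_le_iff.2 ⟨by positivity, ?_⟩
  have p0 := pow_le_pow_left₀ (abs_nonneg _) hi 2
  have p1 := pow_le_pow_left₀ (abs_nonneg _) (hc 0) 2
  have p2 := pow_le_pow_left₀ (abs_nonneg _) (hc 1) 2
  nlinarith

theorem hausdorffMeasure_cap_inter_closedBall_le (x : EuclideanSpace ℝ (Fin 3)) {r : ℝ}
    (hr : 0 ≤ r) (i : Fin 3) {s : ℝ} (hs : s ^ 2 = 1) :
    μH[2] {y : EuclideanSpace ℝ (Fin 3) | ‖y‖ = 1 ∧ 1 / 2 ≤ s * y i ∧ y ∈ closedBall x r} ≤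
      ENNReal.ofReal (144 * r ^ 2) := by
  set A := {y : EuclideanSpace ℝ (Fin 3) | ‖y‖ = 1 ∧ 1 / 2 ≤ s * y i ∧ y ∈ closedBall x r}
  have h := hausdorffMeasure_le_of_edist_le (s := A) (K := 6) (d := 2)
    (f := fun y : EuclideanSpace ℝ (Fin 3) => (i.removeNth y : Fin 2 → ℝ)) (fun a ha b hb => by
      have := dist_le_six_mul_dist_removeNth ha.1 hb.1 hs ha.2.1 hb.2.1
      rw [edist_dist, edist_dist]
      refine (ENNReal.ofReal_le_ofReal this).trans_eq ?_
      rw [ENNReal.ofReal_mul (by norm_num)]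
      norm_num) (by norm_num)
  refine h.trans ?_
  have hsub : (fun y : EuclideanSpace ℝ (Fin 3) => (i.removeNth y : Fin 2 → ℝ)) '' A ⊆
      closedBall (i.removeNth x) r := by
    rintro _ ⟨y, hy, rfl⟩
    refine (dist_pi_le_iff hr).2 fun j => ?_
    have := PiLp.norm_apply_le (y - x) (i.succAbove j)
    exact this.trans (by simpa [dist_eq_norm] using hy.2.2)
  have hv : (μH[2] : Measure (Fin 2 → ℝ)) = volume := by
    simpa using hausdorffMeasure_pi_real (ι := Fin 2)
  calc _ ≤ ((6 : NNReal) : ENNReal) ^ (2 : ℝ) *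
          volume (closedBall (i.removeNth x : Fin 2 → ℝ) r) := by
        rw [hv]; gcongr
    _ = _ := by
        rw [Real.volume_pi_closedBall _ hr, Fintype.card_fin,
          show (144 : ℝ) * r ^ 2 = 36 * (2 * r) ^ 2 by ring, ENNReal.ofReal_mul (by norm_num)]
        norm_num

theorem hausdorffMeasure_sphere_inter_closedBall_le (x : EuclideanSpace ℝ (Fin 3)) {r : ℝ}
    (hr : 0 ≤ r) :
    μH[2] (sphere (0 : EuclideanSpace ℝ (Fin 3)) 1 ∩ closedBall x r) ≤
      ENNReal.ofReal (864 * r ^ 2) := by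
  let A (p : Fin 3 × Fin 2) : Set (EuclideanSpace ℝ (Fin 3)) :=
    {y | ‖y‖ = 1 ∧ 1 / 2 ≤ (-1) ^ (p.2 : ℕ) * y p.1 ∧ y ∈ closedBall x r}
  have hsub : sphere (0 : EuclideanSpace ℝ (Fin 3)) 1 ∩ closedBall x r ⊆ ⋃ p, A p := by
    rintro y ⟨hy, hyr⟩
    have hy1 : ‖y‖ = 1 := by simpa using hy
    have : ∃ i, 1 / 2 ≤ |y i| := by
      by_contra! hlt
      have := EuclideanSpace.real_norm_sq_eq y
      rw [Fin.sum_univ_three, hy1] at this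
      have p (i : Fin 3) : y i ^ 2 ≤ (1 / 2) ^ 2 := by
        rw [← sq_abs]; exact pow_le_pow_left₀ (abs_nonneg _) (hlt i).le 2
      linarith [p 0, p 1, p 2]
    obtain ⟨i, hi⟩ := this
    rw [Set.mem_iUnion]
    rcases le_abs.1 hi with h | h
    · exact ⟨(i, 0), hy1, by simpa using h, hyr⟩
    · exact ⟨(i, 1), hy1, by simpa using h, hyr⟩
  calc _ ≤ ∑ p, μH[2] (A p) := (measure_mono hsub).trans (measure_iUnion_fintype_le _ _)
    _ ≤ ∑ _p : Fin 3 × Fin 2, ENNReal.ofReal (144 * r ^ 2) :=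
        Finset.sum_le_sum fun p _ => hausdorffMeasure_cap_inter_closedBall_le x hr p.1
          (by rw [← pow_mul, mul_comm, pow_mul]; norm_num)
    _ = _ := by
        rw [← ENNReal.ofReal_sum_of_nonneg fun _ _ => by positivity]
        congr 1
        simp
        ring

open Set in
theorem lintegral_ofReal_le_of_meas_lt_le {α : Type*} [MeasurableSpace α] {ν : Measure α}
    {g : α → ℝ} (hg : AEMeasurable g ν) (hg0 : 0 ≤ᵐ[ν] g) {a b : ℝ} (ha : 0 < a) (hb : 0 < b)
    (h1 : ν univ ≤ ENNReal.ofReal (b ^ 2))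
    (h2 : ∀ t, 0 < t → ν {y | t < g y} ≤ ENNReal.ofReal (a ^ 2 / t ^ 2)) :
    ∫⁻ y, ENNReal.ofReal (g y) ∂ν ≤ ENNReal.ofReal (2 * (a * b)) := by
  have ht0 : 0 < a / b := by positivity
  rw [lintegral_eq_lintegral_meas_lt ν hg0 hg, ← Ioc_union_Ioi_eq_Ioi ht0.le]
  refine (lintegral_union_le _ _ _).trans ?_
  rw [two_mul, ENNReal.ofReal_add (by positivity) (by positivity)]
  gcongr ?_ + ?_
  · calc _ ≤ ∫⁻ _ in Ioc 0 (a / b), ENNReal.ofReal (b ^ 2) :=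
          lintegral_mono fun t => (measure_mono (subset_univ _)).trans h1
      _ = _ := by
          rw [setLIntegral_const, Real.volume_Ioc, ← ENNReal.ofReal_mul (by positivity)]
          congr 1
          field_simp
          ring
  · calc _ ≤ ∫⁻ t in Ioi (a / b), ENNReal.ofReal (a ^ 2 * t ^ (-2 : ℝ)) := by
          refine setLIntegral_mono' measurableSet_Ioi fun t ht => ?_
          have ht' : 0 < t := ht0.trans ht
          refine (h2 t ht').trans_eq ?_
          rw [Real.rpow_neg ht'.le, div_eq_mul_inv]
          norm_cast
      _ = ENNReal.ofReal (∫ t in Ioi (a / b), a ^ 2 * t ^ (-2 : ℝ)) := by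
          rw [ofReal_integral_eq_lintegral_ofReal]
          · exact (integrableOn_Ioi_rpow_of_lt (by norm_num) ht0).const_mul _
          · filter_upwards [ae_restrict_mem measurableSet_Ioi] with t ht
            have ht' : 0 < t := ht0.trans ht
            positivity
      _ ≤ _ := by
          rw [integral_const_mul, integral_Ioi_rpow_of_lt (by norm_num) ht0]
          apply ENNReal.ofReal_le_ofReal
          rw [show (-2 : ℝ) + 1 = -1 by norm_num, Real.rpow_neg_one]
          apply le_of_eq
          field_simp

/-- There is a universal constant `C > 0` such that for every bounded
measurable `f : S² → ℝ` and every `x ∈ S²`,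
`∫_{S²} |f(y)| / ‖x − y‖ dσ(y) ≤ C √(‖f‖_{L∞} ‖f‖_{L¹})`,
where `σ` is the 2-dimensional Hausdorff measure restricted to the unit sphere of `ℝ³`. -/
theorem stmt0 :
    ∃ C : ℝ, 0 < C ∧
      ∀ f : EuclideanSpace ℝ (Fin 3) → ℝ, Measurable f →
        (∃ M : ℝ, ∀ y, |f y| ≤ M) →
        ∀ x ∈ sphere (0 : EuclideanSpace ℝ (Fin 3)) 1,
          ∫ y in sphere (0 : EuclideanSpace ℝ (Fin 3)) 1, |f y| / ‖x - y‖ ∂(μH[2]) ≤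
            C * Real.sqrt
              ((eLpNorm f ⊤ ((μH[2]).restrict (sphere (0 : EuclideanSpace ℝ (Fin 3)) 1))).toReal *
                ∫ y in sphere (0 : EuclideanSpace ℝ (Fin 3)) 1, |f y| ∂(μH[2])) := by
  refine ⟨60, by norm_num, ?_⟩
  rintro f hf ⟨B, hB⟩ x -
  set σ := (μH[2] : Measure (EuclideanSpace ℝ (Fin 3))).restrict (sphere 0 1) with hσ
  have hball {r : ℝ} (hr : 0 ≤ r) (z : EuclideanSpace ℝ (Fin 3)) :
      σ (closedBall z r) ≤ ENNReal.ofReal (864 * r ^ 2) := by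
    rw [hσ, Measure.restrict_apply measurableSet_closedBall, Set.inter_comm]
    exact hausdorffMeasure_sphere_inter_closedBall_le z hr
  have hfin : IsFiniteMeasure σ := by
    refine ⟨?_⟩
    rw [hσ, Measure.restrict_apply_univ]
    have h := hausdorffMeasure_sphere_inter_closedBall_le 0 zero_le_one
    rw [Set.inter_eq_left.2 sphere_subset_closedBall] at h
    exact h.trans_lt ENNReal.ofReal_lt_top
  have hmem : MemLp f ⊤ σ :=
    memLp_top_of_bound hf.aestronglyMeasurable B (Filter.Eventually.of_forall hB)
  have hint : Integrable (fun y => |f y|) σ := (hmem.integrable le_top).abs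
  set M := (eLpNorm f ⊤ σ).toReal with hM
  set L := ∫ y, |f y| ∂σ with hL
  have hM0 : 0 ≤ M := ENNReal.toReal_nonneg
  have hL0 : 0 ≤ L := integral_nonneg fun _ => abs_nonneg _
  have hfM : ∀ᵐ y ∂σ, |f y| ≤ M := by
    filter_upwards [ae_le_eLpNormEssSup (f := f) (μ := σ)] with y hy
    rw [← eLpNorm_exponent_top] at hy
    exact (toReal_enorm (f y)).symm.trans_le (ENNReal.toReal_mono hmem.eLpNorm_ne_top hy)
  have hzero (h : ∀ᵐ y ∂σ, |f y| = 0) :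
      ∫ y, |f y| / ‖x - y‖ ∂σ ≤ 60 * Real.sqrt (M * L) := by
    rw [integral_eq_zero_of_ae]
    · positivity
    · filter_upwards [h] with y hy
      simp [hy]
  rcases hM0.eq_or_lt with hM1 | hM1
  · apply hzero
    filter_upwards [hfM] with y hy
    exact le_antisymm (hM1 ▸ hy) (abs_nonneg _)
  rcases hL0.eq_or_lt with hL1 | hL1
  · exact hzero ((integral_eq_zero_iff_of_nonneg (fun _ => abs_nonneg _) hint).1 hL1.symm)
  have hfm : Measurable fun y => ENNReal.ofReal |f y| := by fun_prop
  have hgm : Measurable fun y => ‖x - y‖⁻¹ := by fun_prop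
  have hmain := lintegral_ofReal_le_of_meas_lt_le
    (ν := σ.withDensity fun y => ENNReal.ofReal |f y|) (g := fun y => ‖x - y‖⁻¹)
    (a := 30 * √M) (b := √L) hgm.aemeasurable
    (Filter.Eventually.of_forall fun y => inv_nonneg.2 (norm_nonneg _))
    (by positivity) (by positivity)
    (by
      rw [withDensity_apply _ MeasurableSet.univ, Measure.restrict_univ, Real.sq_sqrt hL0, hL,
        ofReal_integral_eq_lintegral_ofReal hint (Filter.Eventually.of_forall fun _ => abs_nonneg _)])
    (by
      intro t ht
      have hsub : {y | t < ‖x - y‖⁻¹} ⊆ closedBall x t⁻¹ := by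
        intro y hy
        rw [mem_closedBall', dist_eq_norm]
        exact (le_inv_comm₀ ht (inv_pos.1 (ht.trans hy))).1 (le_of_lt hy)
      refine (measure_mono hsub).trans ?_
      rw [withDensity_apply _ measurableSet_closedBall]
      calc _ ≤ ∫⁻ _ in closedBall x t⁻¹, ENNReal.ofReal M ∂σ :=
            lintegral_mono_ae <| (ae_restrict_of_ae hfM).mono fun y hy =>
              ENNReal.ofReal_le_ofReal hy
        _ ≤ ENNReal.ofReal M * ENNReal.ofReal (864 * t⁻¹ ^ 2) := by
            rw [setLIntegral_const]
            gcongr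
            exact hball (by positivity) x
        _ ≤ _ := by
            rw [← ENNReal.ofReal_mul hM0]
            apply ENNReal.ofReal_le_ofReal
            rw [mul_pow, Real.sq_sqrt hM0, inv_pow, div_eq_mul_inv, ← mul_assoc]
            gcongr ?_ * _
            linarith)
  rw [lintegral_withDensity_eq_lintegral_mul _ hfm (by fun_prop)] at hmain
  rw [integral_eq_lintegral_of_nonneg_ae (Filter.Eventually.of_forall fun y => by positivity)
    (Measurable.aestronglyMeasurable (by fun_prop))]
  refine ENNReal.toReal_le_of_le_ofReal (by positivity) ?_
  calc _ = _ := lintegral_congr fun y => by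
        rw [div_eq_mul_inv, ENNReal.ofReal_mul (abs_nonneg _)]; rfl
    _ ≤ _ := hmain
    _ = _ := by rw [Real.sqrt_mul hM0]; congr 1; ring
end

section
/- There exists a universal constant C > 0 such that for every bounded measurable function ω : S² → ℝ and every x ∈ S², the ℝ³-valued integral u(x) := ∫_{S²} ((x − y)/‖x − y‖²) · ω(y) dσ(y) satisfies ‖u(x)‖ ≤ C · √(‖ω‖_{L∞(S²)} · ‖ω‖_{L¹(S²)}). -/
open MeasureTheory Metric

/-- Radial projection onto the unit sphere is `2`-Lipschitz outside the open unit ball. -/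
lemma lipschitzOnWith_inv_norm_smul {E : Type*} [NormedAddCommGroup E] [NormedSpace ℝ E] :
    LipschitzOnWith 2 (fun z : E => ‖z‖⁻¹ • z) {z | 1 ≤ ‖z‖} := by
  refine LipschitzOnWith.of_dist_le_mul fun a ha b hb => ?_
  simp only [Set.mem_ofPred_eq] at ha hb
  have ha0 : (0 : ℝ) < ‖a‖ := by linarith
  have hb0 : (0 : ℝ) < ‖b‖ := by linarith
  have key : ‖a‖⁻¹ • a - ‖b‖⁻¹ • b = ‖a‖⁻¹ • (a - b) + (‖a‖⁻¹ - ‖b‖⁻¹) • b := by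
    module
  have h1 : ‖‖a‖⁻¹ • (a - b)‖ ≤ ‖a - b‖ := by
    rw [norm_smul, norm_inv, norm_norm]
    exact mul_le_of_le_one_left (norm_nonneg _) (inv_le_one_of_one_le₀ ha)
  have h2 : ‖(‖a‖⁻¹ - ‖b‖⁻¹) • b‖ ≤ ‖a - b‖ := by
    have : (‖a‖⁻¹ - ‖b‖⁻¹) = (‖b‖ - ‖a‖) * ‖a‖⁻¹ * ‖b‖⁻¹ := by field_simp
    rw [norm_smul, this, norm_mul, norm_mul, norm_inv, norm_inv, norm_norm, norm_norm,
      mul_assoc, inv_mul_cancel₀ hb0.ne', mul_one, Real.norm_eq_abs]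
    calc |‖b‖ - ‖a‖| * ‖a‖⁻¹ ≤ |‖b‖ - ‖a‖| :=
          mul_le_of_le_one_right (abs_nonneg _) (inv_le_one_of_one_le₀ ha)
      _ ≤ ‖b - a‖ := abs_norm_sub_norm_le _ _
      _ = ‖a - b‖ := norm_sub_rev _ _
  rw [dist_eq_norm, dist_eq_norm, key, NNReal.coe_ofNat]
  linarith [norm_add_le (‖a‖⁻¹ • (a - b)) ((‖a‖⁻¹ - ‖b‖⁻¹) • b)]

/-- The `2`-dimensional Hausdorff measure of a closed ball of radius `r` in the plane. -/
lemma hausdorffMeasure_two_closedBall (r : ℝ) (hr : 0 ≤ r) :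
    μH[2] (closedBall (0 : EuclideanSpace ℝ (Fin 2)) r) =
      ENNReal.ofReal (r ^ 2) * μH[2] (closedBall (0 : EuclideanSpace ℝ (Fin 2)) 1) := by
  have h : Measure.IsAddHaarMeasure (μH[2] : Measure (EuclideanSpace ℝ (Fin 2))) := by
    have := isAddHaarMeasure_hausdorffMeasure (E := EuclideanSpace ℝ (Fin 2))
    rwa [finrank_euclideanSpace_fin, Nat.cast_ofNat] at this
  rw [Measure.addHaar_closedBall' _ _ hr, finrank_euclideanSpace_fin]

lemma hausdorffMeasure_two_closedBall_one_lt_top :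
    μH[2] (closedBall (0 : EuclideanSpace ℝ (Fin 2)) 1) < ⊤ := by
  have h : Measure.IsAddHaarMeasure (μH[2] : Measure (EuclideanSpace ℝ (Fin 2))) := by
    have := isAddHaarMeasure_hausdorffMeasure (E := EuclideanSpace ℝ (Fin 2))
    rwa [finrank_euclideanSpace_fin, Nat.cast_ofNat] at this
  exact measure_closedBall_lt_top

/-- Area bound for a spherical cap of radius at most one. -/
lemma hausdorffMeasure_sphere_inter_ball_le {x : EuclideanSpace ℝ (Fin 3)}
    (hx : x ∈ sphere (0 : EuclideanSpace ℝ (Fin 3)) 1) {r : ℝ} (hr : r ≤ 1) :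
    μH[2] (sphere (0 : EuclideanSpace ℝ (Fin 3)) 1 ∩ ball x r) ≤
      16 * μH[2] (closedBall (0 : EuclideanSpace ℝ (Fin 2)) 1) * ENNReal.ofReal (r ^ 2) := by
  rcases le_or_gt r 0 with hr0 | hr0
  · simp [ball_eq_empty.2 hr0]
  have hx1 : ‖x‖ = 1 := by simpa using hx
  have hxx : inner ℝ x x = (1 : ℝ) := by simp [hx1]
  have hxne : x ≠ 0 := by rintro rfl; simp at hx1
  have : Fact (Module.finrank ℝ (EuclideanSpace ℝ (Fin 3)) = 2 + 1) := ⟨by simp⟩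
  let U := (OrthonormalBasis.fromOrthogonalSpanSingleton (𝕜 := ℝ) 2 hxne).repr
  let g : EuclideanSpace ℝ (Fin 2) → EuclideanSpace ℝ (Fin 3) := fun v => x + (U.symm v : _)
  have hg : LipschitzWith 1 g := by
    refine LipschitzWith.of_dist_le_mul fun a b => ?_
    simp only [g, dist_add_left, NNReal.coe_one, one_mul]
    rw [← Subtype.dist_eq, U.symm.dist_map]
  have hg1 : ∀ v, 1 ≤ ‖g v‖ := by
    intro v
    have h0 : inner ℝ x (U.symm v : EuclideanSpace ℝ (Fin 3)) = (0 : ℝ) :=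
      Submodule.mem_orthogonal_singleton_iff_inner_right.1 (U.symm v).2
    have h1 : inner ℝ x (g v) = (1 : ℝ) := by simp only [g, inner_add_right, h0, hxx, add_zero]
    have := real_inner_le_norm x (g v)
    rwa [h1, hx1, one_mul] at this
  have hf : LipschitzOnWith 2 (fun v => ‖g v‖⁻¹ • g v) (closedBall 0 (2 * r)) := by
    have := (lipschitzOnWith_inv_norm_smul (E := EuclideanSpace ℝ (Fin 3))).comp
      (hg.lipschitzOnWith (s := closedBall 0 (2 * r))) (fun v _ => hg1 v)
    rw [mul_one] at this
    exact this
  have hsub : sphere (0 : EuclideanSpace ℝ (Fin 3)) 1 ∩ ball x r ⊆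
      (fun v => ‖g v‖⁻¹ • g v) '' closedBall 0 (2 * r) := by
    rintro y ⟨hy, hyr⟩
    have hy1 : ‖y‖ = 1 := by simpa using hy
    have hd : ‖y - x‖ < r := by simpa [dist_eq_norm] using hyr
    set c : ℝ := inner ℝ x y with hc
    have hexp : ‖y - x‖ ^ 2 = 2 - 2 * c := by
      rw [norm_sub_sq_real, hx1, hy1, real_inner_comm]; ring
    have hc2 : 1 / 2 ≤ c := by nlinarith [norm_nonneg (y - x)]
    have hc0 : 0 < c := by linarith
    have hwmem : c⁻¹ • y - x ∈ (Submodule.span ℝ {x})ᗮ := by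
      rw [Submodule.mem_orthogonal_singleton_iff_inner_right, inner_sub_right, inner_smul_right,
        ← hc, hxx, inv_mul_cancel₀ hc0.ne', sub_self]
    have hw : ‖c⁻¹ • y - x‖ ≤ 2 * r := by
      have h2 : ‖c⁻¹ • y - x‖ ^ 2 = c⁻¹ ^ 2 - 1 := by
        rw [norm_sub_sq_real, norm_smul, hx1, hy1, inner_smul_left, real_inner_comm, ← hc]
        simp only [norm_inv, Real.norm_eq_abs, abs_of_pos hc0, conj_trivial]
        field_simp
        ring
      have hci : c⁻¹ ≤ 2 := by
        rw [inv_le_comm₀ hc0 two_pos]; linarith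
      have hcic : c⁻¹ * c = 1 := inv_mul_cancel₀ hc0.ne'
      have hci1 : c⁻¹ - 1 = c⁻¹ * (‖y - x‖ ^ 2 / 2) := by rw [hexp]; linarith
      have hci0 : 0 < c⁻¹ := inv_pos.2 hc0
      have h3 : c⁻¹ - 1 ≤ ‖y - x‖ ^ 2 := by
        rw [hci1]; nlinarith [sq_nonneg ‖y - x‖]
      have h4 : c⁻¹ ^ 2 - 1 ≤ (2 * r) ^ 2 := by
        have : ‖y - x‖ ^ 2 ≤ r ^ 2 := by gcongr
        nlinarith [sq_nonneg ‖y - x‖]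
      exact le_of_sq_le_sq (h2.trans_le h4) (by positivity)
    refine ⟨U ⟨_, hwmem⟩, ?_, ?_⟩
    · rw [mem_closedBall_zero_iff, U.norm_map]
      exact hw
    · have hgy : g (U ⟨_, hwmem⟩) = c⁻¹ • y := by simp [g]
      simp only [hgy]
      rw [norm_smul, hy1, mul_one, norm_inv, Real.norm_eq_abs, abs_of_pos hc0, inv_inv, smul_smul,
        mul_inv_cancel₀ hc0.ne', one_smul]
  calc μH[2] (sphere (0 : EuclideanSpace ℝ (Fin 3)) 1 ∩ ball x r)
      ≤ _ := measure_mono hsub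
    _ ≤ _ := hf.hausdorffMeasure_image_le zero_le_two
    _ = _ := by
      rw [hausdorffMeasure_two_closedBall _ (by positivity), mul_pow,
        ENNReal.ofReal_mul (by positivity)]
      have h4 : ENNReal.ofReal (2 ^ 2) = 4 := by norm_num
      have h2 : ((2 : NNReal) : ENNReal) ^ (2 : ℝ) = 4 := by norm_num
      rw [h4, h2]
      ring

lemma hausdorffMeasure_sphere_lt_top :
    μH[2] (sphere (0 : EuclideanSpace ℝ (Fin 3)) 1) < ⊤ := by
  refine (isCompact_sphere _ _).measure_lt_top_of_nhdsWithin fun x hx => ?_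
  refine ⟨sphere 0 1 ∩ ball x 1,
    inter_mem_nhdsWithin _ (ball_mem_nhds x one_pos), ?_⟩
  refine (hausdorffMeasure_sphere_inter_ball_le hx le_rfl).trans_lt ?_
  exact ENNReal.mul_lt_top (ENNReal.mul_lt_top (by simp) hausdorffMeasure_two_closedBall_one_lt_top)
    ENNReal.ofReal_lt_top

/-- Quadratic growth of the surface measure of the unit sphere. -/
lemma exists_restrict_sphere_ball_le : ∃ K : NNReal,
    ∀ x ∈ sphere (0 : EuclideanSpace ℝ (Fin 3)) 1, ∀ r : ℝ,
      (μH[2]).restrict (sphere (0 : EuclideanSpace ℝ (Fin 3)) 1) (ball x r) ≤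
        K * ENNReal.ofReal (r ^ 2) := by
  set A := 16 * μH[2] (closedBall (0 : EuclideanSpace ℝ (Fin 2)) 1)
  set B := μH[2] (sphere (0 : EuclideanSpace ℝ (Fin 3)) 1)
  have hA : A ≠ ⊤ := ENNReal.mul_ne_top (by simp) hausdorffMeasure_two_closedBall_one_lt_top.ne
  have hB : B ≠ ⊤ := hausdorffMeasure_sphere_lt_top.ne
  refine ⟨(A + B).toNNReal, fun x hx r => ?_⟩
  rw [ENNReal.coe_toNNReal (ENNReal.add_ne_top.2 ⟨hA, hB⟩),
    Measure.restrict_apply measurableSet_ball, Set.inter_comm]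
  rcases le_or_gt r 1 with hr | hr
  · exact (hausdorffMeasure_sphere_inter_ball_le hx hr).trans (by gcongr; exact le_self_add)
  · calc μH[2] (sphere (0 : EuclideanSpace ℝ (Fin 3)) 1 ∩ ball x r) ≤ B :=
          measure_mono Set.inter_subset_left
      _ ≤ A + B := le_add_self
      _ ≤ (A + B) * ENNReal.ofReal (r ^ 2) :=
          le_mul_of_one_le_right' (ENNReal.one_le_ofReal.2 (by nlinarith))

/-- For a measure of quadratic growth at `x`, the integral of `1 / dist x y` over a ball centred at
`x` grows at most linearly. -/
lemma lintegral_ball_inv_dist_le {X : Type*} [PseudoMetricSpace X] [MeasurableSpace X]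
    [OpensMeasurableSpace X] {μ : Measure X} {x : X} {K : ENNReal}
    (h : ∀ r : ℝ, μ (ball x r) ≤ K * ENNReal.ofReal (r ^ 2)) {r : ℝ} (hr : 0 < r) :
    ∫⁻ y in ball x r, ENNReal.ofReal (dist x y)⁻¹ ∂μ ≤ K * ENNReal.ofReal (16 * r) := by
  have hpt : ∀ y ∈ ball x r, ENNReal.ofReal (dist x y)⁻¹ ≤ ∑' n : ℕ,
      (ball x (2 * r / 2 ^ n)).indicator (fun _ => ENNReal.ofReal (2 ^ (n + 1) / r)) y := by
    intro y hy
    rcases (dist_nonneg (x := x) (y := y)).eq_or_lt with h0 | h0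
    · simp [← h0]
    have hy' : dist x y < r := by rwa [mem_ball'] at hy
    obtain ⟨n, hn1, hn2⟩ := exists_nat_pow_near (x := r / dist x y) (y := 2)
      ((one_le_div h0).2 hy'.le) one_lt_two
    have hlt : dist x y < 2 * r / 2 ^ n := by
      rw [le_div_iff₀ h0] at hn1
      rw [lt_div_iff₀ (by positivity)]
      linarith
    refine le_trans ?_ (ENNReal.le_tsum n)
    rw [Set.indicator_of_mem (mem_ball'.2 hlt)]
    refine ENNReal.ofReal_le_ofReal ?_
    rw [le_div_iff₀ hr, mul_comm, ← div_eq_mul_inv]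
    exact hn2.le
  have hterm : ∀ n : ℕ, ENNReal.ofReal (2 ^ (n + 1) / r) * μ (ball x (2 * r / 2 ^ n)) ≤
      K * ENNReal.ofReal (8 * r * (1 / 2) ^ n) := by
    intro n
    calc ENNReal.ofReal (2 ^ (n + 1) / r) * μ (ball x (2 * r / 2 ^ n))
        ≤ ENNReal.ofReal (2 ^ (n + 1) / r) * (K * ENNReal.ofReal ((2 * r / 2 ^ n) ^ 2)) := by
          gcongr
          exact h _
      _ = K * ENNReal.ofReal (2 ^ (n + 1) / r * (2 * r / 2 ^ n) ^ 2) := by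
          rw [ENNReal.ofReal_mul (by positivity)]
          ring
      _ = K * ENNReal.ofReal (8 * r * (1 / 2) ^ n) := by
          congr 2
          rw [one_div, inv_pow]
          field_simp
          ring
  calc ∫⁻ y in ball x r, ENNReal.ofReal (dist x y)⁻¹ ∂μ
      ≤ ∫⁻ y in ball x r, ∑' n : ℕ, (ball x (2 * r / 2 ^ n)).indicator
          (fun _ => ENNReal.ofReal (2 ^ (n + 1) / r)) y ∂μ :=
        setLIntegral_mono' measurableSet_ball hpt
    _ ≤ ∫⁻ y, ∑' n : ℕ, (ball x (2 * r / 2 ^ n)).indicator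
          (fun _ => ENNReal.ofReal (2 ^ (n + 1) / r)) y ∂μ := setLIntegral_le_lintegral _ _
    _ = ∑' n : ℕ, ENNReal.ofReal (2 ^ (n + 1) / r) * μ (ball x (2 * r / 2 ^ n)) := by
        rw [lintegral_tsum fun n => (measurable_const.indicator measurableSet_ball).aemeasurable]
        simp_rw [lintegral_indicator_const measurableSet_ball]
    _ ≤ ∑' n : ℕ, K * ENNReal.ofReal (8 * r * (1 / 2) ^ n) := ENNReal.tsum_le_tsum hterm
    _ = K * ENNReal.ofReal (16 * r) := by
        rw [ENNReal.tsum_mul_left, ← ENNReal.ofReal_tsum_of_nonneg (fun n => by positivity)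
          (summable_geometric_two.mul_left _), tsum_mul_left, tsum_geometric_two]
        congr 2
        ring

/-- A kernel of size `1 / dist x y` against a measure of quadratic growth at `x` maps
`L^1 ∩ L^∞` to `L^∞`, with the norm controlled by the geometric mean. -/
lemma lintegral_mul_inv_dist_le {X : Type*} [PseudoMetricSpace X] [MeasurableSpace X]
    [OpensMeasurableSpace X] {μ : Measure X} {x : X} {K : NNReal}
    (h : ∀ r : ℝ, μ (ball x r) ≤ K * ENNReal.ofReal (r ^ 2)) {ω : X → ℝ} (hω : Integrable ω μ)
    {M : ℝ} (hM : ∀ᵐ y ∂μ, |ω y| ≤ M) :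
    ∫⁻ y, ENNReal.ofReal (|ω y| * (dist x y)⁻¹) ∂μ ≤
      ENNReal.ofReal ((1 + 16 * K) * √(M * ∫ y, |ω y| ∂μ)) := by
  set A := ∫ y, |ω y| ∂μ with hA
  have hA0 : 0 ≤ A := integral_nonneg fun y => abs_nonneg _
  have hzero : (∀ᵐ y ∂μ, ω y = 0) → ∫⁻ y, ENNReal.ofReal (|ω y| * (dist x y)⁻¹) ∂μ ≤
      ENNReal.ofReal ((1 + 16 * K) * √(M * A)) := by
    intro h0
    rw [lintegral_congr_ae (g := fun _ => 0) (by filter_upwards [h0] with y hy; simp [hy])]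
    simp
  rcases hA0.eq_or_lt with hA1 | hA1
  · have := (integral_eq_zero_iff_of_nonneg (fun y => abs_nonneg (ω y)) hω.abs).1 hA1.symm
    exact hzero (this.mono fun y hy => abs_eq_zero.1 hy)
  rcases le_or_gt M 0 with hM1 | hM1
  · exact hzero (hM.mono fun y hy => abs_nonpos_iff.1 (hy.trans hM1))
  set r := √(A / M) with hrdef
  have hr : 0 < r := Real.sqrt_pos.2 (div_pos hA1 hM1)
  have hr2 : r ^ 2 = A / M := Real.sq_sqrt (div_pos hA1 hM1).le
  have hMr : M * r = √(M * A) := by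
    rw [eq_comm, Real.sqrt_eq_iff_mul_self_eq (by positivity) (by positivity)]
    calc M * A = M ^ 2 * r ^ 2 := by rw [hr2]; field_simp
      _ = M * r * (M * r) := by ring
  have hAr : A * r⁻¹ = √(M * A) := by
    rw [← hMr, ← div_eq_mul_inv, div_eq_iff hr.ne', mul_assoc, ← sq, hr2]
    field_simp
  have hpt : ∀ᵐ y ∂μ, ENNReal.ofReal (|ω y| * (dist x y)⁻¹) ≤
      ENNReal.ofReal (|ω y|) * ENNReal.ofReal r⁻¹ +
        (ball x r).indicator (fun y => ENNReal.ofReal M * ENNReal.ofReal (dist x y)⁻¹) y := by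
    filter_upwards [hM] with y hy
    rw [ENNReal.ofReal_mul (abs_nonneg _)]
    by_cases hyr : y ∈ ball x r
    · rw [Set.indicator_of_mem hyr]
      refine le_trans ?_ le_add_self
      gcongr
    · rw [Set.indicator_of_notMem hyr, add_zero]
      rw [mem_ball', not_lt] at hyr
      gcongr
  calc ∫⁻ y, ENNReal.ofReal (|ω y| * (dist x y)⁻¹) ∂μ
      ≤ ∫⁻ y, (ENNReal.ofReal (|ω y|) * ENNReal.ofReal r⁻¹ +
        (ball x r).indicator (fun y => ENNReal.ofReal M * ENNReal.ofReal (dist x y)⁻¹) y) ∂μ :=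
        lintegral_mono_ae hpt
    _ = ENNReal.ofReal A * ENNReal.ofReal r⁻¹ +
        ENNReal.ofReal M * ∫⁻ y in ball x r, ENNReal.ofReal (dist x y)⁻¹ ∂μ := by
        rw [lintegral_add_left' (hω.abs.aestronglyMeasurable.aemeasurable.ennreal_ofReal.mul_const _),
          lintegral_mul_const' _ _ ENNReal.ofReal_ne_top, lintegral_indicator measurableSet_ball,
          lintegral_const_mul' _ _ ENNReal.ofReal_ne_top, hA,
          ofReal_integral_eq_lintegral_ofReal hω.abs
            (Filter.Eventually.of_forall fun y => abs_nonneg _)]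
    _ ≤ ENNReal.ofReal A * ENNReal.ofReal r⁻¹ +
        ENNReal.ofReal M * (K * ENNReal.ofReal (16 * r)) := by
        gcongr
        exact lintegral_ball_inv_dist_le h hr
    _ = ENNReal.ofReal ((1 + 16 * K) * √(M * A)) := by
        rw [← ENNReal.ofReal_coe_nnreal, ← ENNReal.ofReal_mul hA0,
          ← ENNReal.ofReal_mul K.coe_nonneg, ← ENNReal.ofReal_mul hM1.le,
          ← ENNReal.ofReal_add (by positivity) (by positivity), hAr, ← hMr]
        congr 1
        ring

/-- There is a universal constant `C > 0` such that for every bounded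
measurable `ω : S² → ℝ` and every `x ∈ S²`, the vector-valued integral
`u(x) = ∫_{S²} ((x − y)/‖x − y‖²) ω(y) dσ(y)` satisfies
`‖u(x)‖ ≤ C √(‖ω‖_{L∞} ‖ω‖_{L¹})`. -/
theorem stmt3 :
    ∃ C : ℝ, 0 < C ∧
      ∀ ω : EuclideanSpace ℝ (Fin 3) → ℝ, Measurable ω →
        (∃ M : ℝ, ∀ y, |ω y| ≤ M) →
        ∀ x ∈ sphere (0 : EuclideanSpace ℝ (Fin 3)) 1,
          ‖∫ y in sphere (0 : EuclideanSpace ℝ (Fin 3)) 1,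
              (ω y / ‖x - y‖ ^ 2) • (x - y) ∂(μH[2])‖ ≤
            C * Real.sqrt
              ((eLpNorm ω ⊤ ((μH[2]).restrict (sphere (0 : EuclideanSpace ℝ (Fin 3)) 1))).toReal *
                ∫ y in sphere (0 : EuclideanSpace ℝ (Fin 3)) 1, |ω y| ∂(μH[2])) := by
  obtain ⟨K, hK⟩ := exists_restrict_sphere_ball_le
  refine ⟨1 + 16 * K, by positivity, fun ω hω ⟨B, hB⟩ x hx => ?_⟩
  set μ := (μH[2]).restrict (sphere (0 : EuclideanSpace ℝ (Fin 3)) 1) with hμ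
  have : IsFiniteMeasure μ := ⟨by simpa [hμ] using hausdorffMeasure_sphere_lt_top⟩
  have hmem : MemLp ω ⊤ μ :=
    memLp_top_of_bound hω.aestronglyMeasurable B (Filter.Eventually.of_forall hB)
  have hM : ∀ᵐ y ∂μ, |ω y| ≤ (eLpNorm ω ⊤ μ).toReal := by
    rw [eLpNorm_exponent_top]
    filter_upwards [enorm_ae_le_eLpNormEssSup ω μ] with y hy
    have := ENNReal.toReal_mono (by simpa using hmem.eLpNorm_ne_top) hy
    simpa using this
  have key := lintegral_mul_inv_dist_le (hK x hx) (hmem.integrable le_top) hM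
  have hpt : ∀ y, ‖(ω y / ‖x - y‖ ^ 2) • (x - y)‖ₑ = ENNReal.ofReal (|ω y| * (dist x y)⁻¹) := by
    intro y
    rw [← ofReal_norm, norm_smul, norm_div, norm_pow, norm_norm, Real.norm_eq_abs, dist_eq_norm]
    congr 1
    rcases eq_or_ne ‖x - y‖ 0 with h0 | h0
    · simp [h0]
    · field_simp
  have h1 := enorm_integral_le_lintegral_enorm (μ := μ) fun y => (ω y / ‖x - y‖ ^ 2) • (x - y)
  simp_rw [hpt] at h1
  have h2 := h1.trans key
  rwa [← ofReal_norm, ENNReal.ofReal_le_ofReal_iff (by positivity)] at h2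
end

section
/- Let N ≥ 2 be an integer, 0 = θ₀ < θ₁ < ... < θ_{N−1} < θ_N = π, γ ∈ ℝ, and let ω₁, ..., ω_N ∈ ℝ be strictly monotone (ω₁ < ω₂ < ... < ω_N or ω₁ > ω₂ > ... > ω_N) and satisfy the Gauss constraint Σ_{k=1}^{N} ω_k (cos θ_k − cos θ_{k−1}) = 0. Define C(j) := Σ_{k=1}^{j} ω_k (cos θ_{k−1} − cos θ_k) (with C(0) = 0) and Φ̇⋆ : (0, π) → ℝ by Φ̇⋆(θ) = γ + (1/sin²θ)(C(j−1) + ω_j (cos θ_{j−1} − cos θ)) whenever θ ∈ [θ_{j−1}, θ_j) ∩ (0, π) for some 1 ≤ j ≤ N. Then for every 1 ≤ k₀ ≤ N−1 there exists μ₀ > 0 such that for all μ with 0 < |μ| < μ₀, one has Φ̇⋆(θ_{k₀} + μ) ≠ Φ̇⋆(θ_{k₀}). -/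
open Real

lemma lt_of_lt_succ_of_mem_Icc {f : ℕ → ℝ} {m N : ℕ}
    (hf : ∀ k, m ≤ k → k < N → f k < f (k + 1)) {i j : ℕ} (hi : m ≤ i) (hij : i < j)
    (hj : j ≤ N) : f i < f j := by
  induction j, hij using Nat.le_induction with
  | base => exact hf i hi (by omega)
  | succ n hn ih => exact (ih (by omega)).trans (hf n (by omega) (by omega))

/-- The proper partial sums of a vanishing sum with positive weights and strictly increasing
values do not vanish. -/
lemma partial_sum_ne_zero_of_strictMono {N k : ℕ} {w d : ℕ → ℝ}
    (hd : ∀ i, 1 ≤ i → i ≤ N → 0 < d i) (hw : ∀ i, 1 ≤ i → i < N → w i < w (i + 1))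
    (hsum : ∑ i ∈ Finset.Icc 1 N, w i * d i = 0) (hk : 1 ≤ k) (hkN : k < N) :
    ∑ i ∈ Finset.Icc 1 k, w i * d i ≠ 0 := by
  intro h0
  have hwk : 0 ≤ w k := by
    by_contra! hneg
    refine (Finset.sum_neg (fun i hi => ?_) ⟨k, by simp [hk]⟩).ne h0
    rw [Finset.mem_Icc] at hi
    have hle : w i ≤ w k := by
      rcases hi.2.eq_or_lt with h | h
      · rw [h]
      · exact (lt_of_lt_succ_of_mem_Icc hw hi.1 h hkN.le).le
    exact mul_neg_of_neg_of_pos (hle.trans_lt hneg) (hd i hi.1 (by omega))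
  have hpos : 0 < ∑ i ∈ Finset.Icc (k + 1) N, w i * d i := by
    refine Finset.sum_pos (fun i hi => ?_) ⟨N, by simp; omega⟩
    rw [Finset.mem_Icc] at hi
    exact mul_pos (hwk.trans_lt (lt_of_lt_succ_of_mem_Icc hw hk (by omega) hi.2))
      (hd i (by omega) hi.2)
  have hsplit : Finset.Icc 1 N = Finset.Icc 1 k ∪ Finset.Icc (k + 1) N := by
    ext i
    simp only [Finset.mem_union, Finset.mem_Icc]
    omega
  rw [hsplit, Finset.sum_union, h0, zero_add] at hsum
  · exact hpos.ne' hsum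
  · rw [Finset.disjoint_left]
    intro i hi hi'
    rw [Finset.mem_Icc] at hi hi'
    omega

lemma eventually_cos_ne {t : ℝ} (ht0 : 0 < t) (htπ : t < π) (y : ℝ) :
    ∀ᶠ x in nhdsWithin t {t}ᶜ, cos x ≠ y := by
  by_cases h : cos t = y
  · filter_upwards [self_mem_nhdsWithin, nhdsWithin_le_nhds (Ioo_mem_nhds ht0 htπ)] with x hx hxI
    intro hxy
    exact hx (injOn_cos ⟨hxI.1.le, hxI.2.le⟩ ⟨ht0.le, htπ.le⟩ (hxy.trans h.symm))
  · exact nhdsWithin_le_nhds (continuous_cos.continuousAt.eventually_ne h)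

/-- The angular velocity of a piece of constant vorticity `w` is non-degenerate at `t` if the
circulation `C` of the cap bounded by the latitude `t` does not vanish. -/
lemma eventually_angular_velocity_ne {t : ℝ} (ht0 : 0 < t) (htπ : t < π) {C : ℝ} (hC : C ≠ 0)
    (w : ℝ) :
    ∀ᶠ x in nhdsWithin t {t}ᶜ,
      1 / sin x ^ 2 * (C + w * (cos t - cos x)) ≠ 1 / sin t ^ 2 * C := by
  have hst := (sin_pos_of_pos_of_lt_pi ht0 htπ).ne'
  filter_upwards [eventually_cos_ne ht0 htπ (cos t),
    eventually_cos_ne ht0 htπ (w * sin t ^ 2 / C - cos t),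
    nhdsWithin_le_nhds (Ioo_mem_nhds ht0 htπ)] with x hx hx' hxI heq
  have hsx := (sin_pos_of_pos_of_lt_pi hxI.1 hxI.2).ne'
  field_simp at heq
  have key : (cos t - cos x) * (w * sin t ^ 2 - C * (cos t + cos x)) = 0 := by
    linear_combination heq + C * sin_sq_add_cos_sq x - C * sin_sq_add_cos_sq t
  rcases mul_eq_zero.1 key with h | h
  · exact hx (by linarith)
  · apply hx'
    field_simp
    linarith

/-- With the zonal-cap setup `0 = θ₀ < ... < θ_N = π`, a strictly monotone
family `ω₁, ..., ω_N` satisfying the Gauss constraint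
`Σ_{k=1}^{N} ω_k (cos θ_k − cos θ_{k−1}) = 0`, and the zonal angular velocity
`Φ̇⋆(θ) = γ + (1/sin²θ)(C(j−1) + ω_j (cos θ_{j−1} − cos θ))` on `[θ_{j−1}, θ_j) ∩ (0,π)`
(where `C(j) = Σ_{k=1}^{j} ω_k (cos θ_{k−1} − cos θ_k)`), for every `1 ≤ k₀ ≤ N−1`
there is `μ₀ > 0` such that `Φ̇⋆(θ_{k₀} + μ) ≠ Φ̇⋆(θ_{k₀})` for all `0 < |μ| < μ₀`. -/
theorem stmt14 (N : ℕ) (hN : 2 ≤ N) (θ ω : ℕ → ℝ) (γ : ℝ)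
    (hθ0 : θ 0 = 0) (hθN : θ N = Real.pi)
    (hmono : ∀ k < N, θ k < θ (k + 1))
    (hωmono : (∀ k, 1 ≤ k → k < N → ω k < ω (k + 1)) ∨
      (∀ k, 1 ≤ k → k < N → ω (k + 1) < ω k))
    (hGauss : (∑ k ∈ Finset.Icc 1 N, ω k * (Real.cos (θ k) - Real.cos (θ (k - 1)))) = 0)
    (Φdot : ℝ → ℝ)
    (hΦdot : ∀ j, 1 ≤ j → j ≤ N → ∀ x, θ (j - 1) ≤ x → x < θ j → 0 < x →
      Φdot x = γ + (1 / Real.sin x ^ 2) *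
        ((∑ k ∈ Finset.Icc 1 (j - 1), ω k * (Real.cos (θ (k - 1)) - Real.cos (θ k))) +
          ω j * (Real.cos (θ (j - 1)) - Real.cos x))) :
    ∀ k₀, 1 ≤ k₀ → k₀ ≤ N - 1 →
      ∃ μ₀ > (0 : ℝ), ∀ μ : ℝ, 0 < |μ| → |μ| < μ₀ →
        Φdot (θ k₀ + μ) ≠ Φdot (θ k₀) := by
  intro k₀ hk₁ hk₂
  have hkN : k₀ < N := by omega
  have hθ : ∀ {i j : ℕ}, i < j → j ≤ N → θ i < θ j := fun {i j} hij hj =>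
    lt_of_lt_succ_of_mem_Icc (m := 0) (fun k _ => hmono k) (Nat.zero_le i) hij hj
  have hnonneg : ∀ i ≤ N, 0 ≤ θ i := by
    intro i hi
    rcases Nat.eq_zero_or_pos i with rfl | h
    · exact hθ0.ge
    · exact hθ0 ▸ (hθ h hi).le
  have hlepi : ∀ i ≤ N, θ i ≤ π := by
    intro i hi
    rcases hi.eq_or_lt with rfl | h
    · exact hθN.le
    · exact hθN ▸ (hθ h le_rfl).le
  have hd : ∀ i, 1 ≤ i → i ≤ N → 0 < cos (θ (i - 1)) - cos (θ i) := fun i h1 hi =>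
    sub_pos.2 (cos_lt_cos_of_nonneg_of_le_pi (hnonneg _ (by omega)) (hlepi i hi)
      (hθ (by omega) hi))
  have hsum : ∑ k ∈ Finset.Icc 1 N, ω k * (cos (θ (k - 1)) - cos (θ k)) = 0 := by
    rw [← neg_eq_zero, ← Finset.sum_neg_distrib, ← hGauss]
    exact Finset.sum_congr rfl fun k _ => by ring
  have hC : ∑ k ∈ Finset.Icc 1 k₀, ω k * (cos (θ (k - 1)) - cos (θ k)) ≠ 0 := by
    rcases hωmono with h | h
    · exact partial_sum_ne_zero_of_strictMono hd h hsum hk₁ hkN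
    · have := partial_sum_ne_zero_of_strictMono (w := fun k => -ω k) hd
        (fun i h1 hi => neg_lt_neg (h i h1 hi)) (by simpa using hsum) hk₁ hkN
      simpa using this
  have ht0 : 0 < θ k₀ := hθ0 ▸ hθ hk₁ hkN.le
  have htπ : θ k₀ < π := hθN ▸ hθ hkN le_rfl
  have hright : ∀ x, θ k₀ ≤ x → x < θ (k₀ + 1) → Φdot x = γ + 1 / sin x ^ 2 *
      ((∑ k ∈ Finset.Icc 1 k₀, ω k * (cos (θ (k - 1)) - cos (θ k))) +
        ω (k₀ + 1) * (cos (θ k₀) - cos x)) := fun x hx hx' =>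
    hΦdot (k₀ + 1) (by omega) hkN x hx hx' (ht0.trans_le hx)
  have hleft : ∀ x, θ (k₀ - 1) < x → x < θ k₀ → Φdot x = γ + 1 / sin x ^ 2 *
      ((∑ k ∈ Finset.Icc 1 k₀, ω k * (cos (θ (k - 1)) - cos (θ k))) +
        ω k₀ * (cos (θ k₀) - cos x)) := by
    intro x hx hx'
    rw [hΦdot k₀ hk₁ hkN.le x hx.le hx' ((hnonneg _ (by omega)).trans_lt hx)]
    obtain ⟨m, rfl⟩ : ∃ m, k₀ = m + 1 := ⟨k₀ - 1, by omega⟩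
    rw [Finset.sum_Icc_succ_top (by omega), Nat.add_sub_cancel]
    ring
  have hcenter := hright (θ k₀) le_rfl (hmono k₀ hkN)
  rw [sub_self, mul_zero, add_zero] at hcenter
  have hev : ∀ᶠ x in nhdsWithin (θ k₀) {θ k₀}ᶜ, Φdot x ≠ Φdot (θ k₀) := by
    filter_upwards [eventually_angular_velocity_ne ht0 htπ hC (ω k₀),
      eventually_angular_velocity_ne ht0 htπ hC (ω (k₀ + 1)),
      nhdsWithin_le_nhds (Ioo_mem_nhds (hθ (Nat.sub_lt hk₁ one_pos) hkN.le) (hmono k₀ hkN))]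
      with x hl hr hxI heq
    rw [hcenter] at heq
    rcases lt_or_ge x (θ k₀) with h | h
    · rw [hleft x hxI.1 h] at heq
      exact hl (add_left_cancel heq)
    · rw [hright x h hxI.2] at heq
      exact hr (add_left_cancel heq)
  rw [eventually_nhdsWithin_iff, Metric.eventually_nhds_iff] at hev
  obtain ⟨ε, hε, hball⟩ := hev
  refine ⟨ε, hε, fun μ hμ hμε => hball (by simpa [Real.dist_eq] using hμε) ?_⟩
  simpa using hμ
end
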